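/- The unique unital ℂ-algebra homomorphism from H(q) to P sending the generator A of H(q) to A and the generator B of H(q) to B is injective; hence the unital subalgebra of P generated by A and B is isomorphic to H(q). -/

import Mathlib

noncomputable section

/-- Generators of the `q`-deformed Heisenberg algebra. -/
inductive HGen : Type
  | A : HGen
  | B : HGen

/-- The defining relation `AB = q • BA + 1` of the `q`-deformed Heisenberg algebra. -/
inductive HRel (q : ℂ) : FreeAlgebra ℂ HGen → FreeAlgebra ℂ HGen → Prop
  | rel : HRel q (FreeAlgebra.ι ℂ HGen.A * FreeAlgebra.ι ℂ HGen.B)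
      (q • (FreeAlgebra.ι ℂ HGen.B * FreeAlgebra.ι ℂ HGen.A) + 1)

/-- The `q`-deformed Heisenberg algebra `H(q)`, presented by generators `A`, `B`
and the single relation `AB - q • BA = 1`. -/
abbrev HAlg (q : ℂ) := RingQuot (HRel q)

/-- The generator `A` of `H(q)`. -/
def genA (q : ℂ) : HAlg q := RingQuot.mkAlgHom ℂ (HRel q) (FreeAlgebra.ι ℂ HGen.A)

/-- The generator `B` of `H(q)`. -/
def genB (q : ℂ) : HAlg q := RingQuot.mkAlgHom ℂ (HRel q) (FreeAlgebra.ι ℂ HGen.B)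

/-- The element `C = AB - BA` of `H(q)`. -/
def genC (q : ℂ) : HAlg q := genA q * genB q - genB q * genA q

/-- Generators of the algebra `P`. -/
inductive PGen : Type
  | K : PGen
  | A : PGen
  | B : PGen
  | C : PGen

/- The defining relations of the algebra `P`, where `q = p ^ 2`:
`(1 - q)AB = 1 - qC`, `(1 - q)BA = 1 - C`, `AC = qCA`, `qBC = CB` (i.e. `BC = q⁻¹CB`),
`pAK = KA` (i.e. `AK = p⁻¹KA`), `BK = pKB`, `CK = KC`, `K²C = 1`. -/
open FreeAlgebra in
inductive PRel (p : ℂ) : FreeAlgebra ℂ PGen → FreeAlgebra ℂ PGen → Prop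
  | ab : PRel p ((1 - p ^ 2) • (ι ℂ PGen.A * ι ℂ PGen.B)) (1 - p ^ 2 • ι ℂ PGen.C)
  | ba : PRel p ((1 - p ^ 2) • (ι ℂ PGen.B * ι ℂ PGen.A)) (1 - ι ℂ PGen.C)
  | ac : PRel p (ι ℂ PGen.A * ι ℂ PGen.C) (p ^ 2 • (ι ℂ PGen.C * ι ℂ PGen.A))
  | bc : PRel p (p ^ 2 • (ι ℂ PGen.B * ι ℂ PGen.C)) (ι ℂ PGen.C * ι ℂ PGen.B)
  | ak : PRel p (p • (ι ℂ PGen.A * ι ℂ PGen.K)) (ι ℂ PGen.K * ι ℂ PGen.A)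
  | bk : PRel p (ι ℂ PGen.B * ι ℂ PGen.K) (p • (ι ℂ PGen.K * ι ℂ PGen.B))
  | ck : PRel p (ι ℂ PGen.C * ι ℂ PGen.K) (ι ℂ PGen.K * ι ℂ PGen.C)
  | k2c : PRel p (ι ℂ PGen.K * ι ℂ PGen.K * ι ℂ PGen.C) 1

/-- The unital associative `ℂ`-algebra `P`, presented by generators `K, A, B, C`
and the relations above. -/
abbrev PAlg (p : ℂ) := RingQuot (PRel p)

/-- The generator `K` of `P`. -/
def pK (p : ℂ) : PAlg p := RingQuot.mkAlgHom ℂ (PRel p) (FreeAlgebra.ι ℂ PGen.K)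

/-- The generator `A` of `P`. -/
def pA (p : ℂ) : PAlg p := RingQuot.mkAlgHom ℂ (PRel p) (FreeAlgebra.ι ℂ PGen.A)

/-- The generator `B` of `P`. -/
def pB (p : ℂ) : PAlg p := RingQuot.mkAlgHom ℂ (PRel p) (FreeAlgebra.ι ℂ PGen.B)

/-- The generator `C` of `P`. -/
def pC (p : ℂ) : PAlg p := RingQuot.mkAlgHom ℂ (PRel p) (FreeAlgebra.ι ℂ PGen.C)

open Polynomial in
/-- The `q`-derivative on polynomials, `X ^ n ↦ (1 - q ^ n) / (1 - q) * X ^ (n - 1)`. -/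
def qDeriv (q : ℂ) : ℂ[X] →ₗ[ℂ] ℂ[X] :=
  Polynomial.lsum fun n => ((1 - q ^ n) / (1 - q)) • monomial (n - 1)

open Polynomial in
/-- The dilation `X ^ n ↦ r ^ n * X ^ n` on polynomials. -/
def qDilate (r : ℂ) : ℂ[X] →ₗ[ℂ] ℂ[X] :=
  Polynomial.lsum fun n => r ^ n • monomial n

open Polynomial in
/-- Multiplication by `X` as a linear map. -/
def mulXLin : ℂ[X] →ₗ[ℂ] ℂ[X] := LinearMap.mulLeft ℂ X

open Polynomial in
lemma qDeriv_monomial (q : ℂ) (n : ℕ) (a : ℂ) :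
    qDeriv q (monomial n a) = monomial (n - 1) ((1 - q ^ n) / (1 - q) * a) := by
  simp [qDeriv, Polynomial.lsum_apply, smul_monomial]

open Polynomial in
lemma qDilate_monomial (r : ℂ) (n : ℕ) (a : ℂ) :
    qDilate r (monomial n a) = monomial n (r ^ n * a) := by
  simp [qDilate, Polynomial.lsum_apply, smul_monomial]

open Polynomial in
lemma mulXLin_monomial (n : ℕ) (a : ℂ) : mulXLin (monomial n a) = monomial (n + 1) a := by
  simp [mulXLin, X_mul_monomial]

lemma genA_mul_genB (q : ℂ) : genA q * genB q = q • (genB q * genA q) + 1 := by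
  simpa [genA, genB] using RingQuot.mkAlgHom_rel ℂ (HRel.rel (q := q))

/-- The homomorphism out of `H(q)` given by a pair satisfying the defining relation. -/
def HAlg.lift {R : Type*} [Ring R] [Algebra ℂ R] (q : ℂ) (a b : R)
    (h : a * b = q • (b * a) + 1) : HAlg q →ₐ[ℂ] R :=
  RingQuot.liftAlgHom ℂ ⟨FreeAlgebra.lift ℂ fun g => HGen.casesOn g a b, by
    rintro _ _ ⟨⟩
    simpa using h⟩

lemma HAlg.lift_genA {R : Type*} [Ring R] [Algebra ℂ R] (q : ℂ) (a b : R)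
    (h : a * b = q • (b * a) + 1) : HAlg.lift q a b h (genA q) = a := by
  simp [HAlg.lift, genA]

lemma HAlg.lift_genB {R : Type*} [Ring R] [Algebra ℂ R] (q : ℂ) (a b : R)
    (h : a * b = q • (b * a) + 1) : HAlg.lift q a b h (genB q) = b := by
  simp [HAlg.lift, genB]

lemma HAlg.hom_ext {R : Type*} [Ring R] [Algebra ℂ R] {q : ℂ} {f g : HAlg q →ₐ[ℂ] R}
    (hA : f (genA q) = g (genA q)) (hB : f (genB q) = g (genB q)) : f = g := by
  apply RingQuot.ringQuot_ext'
  ext x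
  cases x
  · exact hA
  · exact hB

lemma HAlg.adjoin_eq_top (q : ℂ) : Algebra.adjoin ℂ {genA q, genB q} = ⊤ := by
  rw [eq_top_iff]
  rintro x -
  obtain ⟨y, rfl⟩ := RingQuot.mkAlgHom_surjective ℂ (HRel q) x
  induction y with
  | grade0 r => rw [AlgHom.commutes]; exact Subalgebra.algebraMap_mem _ r
  | grade1 g =>
    cases g
    · exact Algebra.subset_adjoin (Set.mem_insert _ _)
    · exact Algebra.subset_adjoin (Set.mem_insert_of_mem _ rfl)
  | mul a b ha hb => rw [map_mul]; exact mul_mem ha hb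
  | add a b ha hb => rw [map_add]; exact add_mem ha hb

lemma pA_mul_pB {p : ℂ} (hp : p ^ 2 ≠ 1) : pA p * pB p = p ^ 2 • (pB p * pA p) + 1 := by
  have h₁ : (1 - p ^ 2) • (pA p * pB p) = 1 - p ^ 2 • pC p := by
    simpa only [pA, pB, pC, map_smul, map_mul, map_sub, map_one] using
      RingQuot.mkAlgHom_rel ℂ (PRel.ab (p := p))
  have h₂ : (1 - p ^ 2) • (pB p * pA p) = 1 - pC p := by
    simpa only [pA, pB, pC, map_smul, map_mul, map_sub, map_one] using
      RingQuot.mkAlgHom_rel ℂ (PRel.ba (p := p))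
  have h : (1 - p ^ 2) ≠ 0 := sub_ne_zero.mpr hp.symm
  apply smul_right_injective _ h
  simp only [smul_add]
  rw [h₁, smul_comm, h₂]
  module

/-- The Fock representation of `P` on polynomials. -/
def fockP {p : ℂ} (hp₀ : p ≠ 0) (hp : p ^ 2 ≠ 1) :
    PAlg p →ₐ[ℂ] Module.End ℂ (Polynomial ℂ) :=
  RingQuot.liftAlgHom ℂ ⟨FreeAlgebra.lift ℂ fun g =>
    PGen.casesOn g (qDilate p⁻¹) (qDeriv (p ^ 2)) mulXLin (qDilate (p ^ 2)), by
    have h : 1 - p ^ 2 ≠ 0 := sub_ne_zero.mpr hp.symm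
    rintro _ _ ⟨⟩ <;>
    · simp only [map_smul, map_mul, map_sub, map_one, FreeAlgebra.lift_ι_apply]
      refine Polynomial.lhom_ext' fun n => LinearMap.ext fun a => ?_
      rcases n with _ | n <;>
      · simp only [LinearMap.comp_apply, LinearMap.smul_apply, LinearMap.sub_apply,
          Module.End.mul_apply, Module.End.one_apply, qDeriv_monomial, qDilate_monomial,
          mulXLin_monomial, Polynomial.smul_monomial, ← map_sub, smul_eq_mul,
          Nat.add_sub_cancel, zero_add, inv_pow]
        first
          | simp; done
          | congr 1; field_simp; done
          | congr 1; field_simp; ring⟩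

lemma fockP_pA {p : ℂ} (hp₀ : p ≠ 0) (hp : p ^ 2 ≠ 1) : fockP hp₀ hp (pA p) = qDeriv (p ^ 2) := by
  simp [fockP, pA]

lemma fockP_pB {p : ℂ} (hp₀ : p ≠ 0) (hp : p ^ 2 ≠ 1) : fockP hp₀ hp (pB p) = mulXLin := by
  simp [fockP, pB]

open Polynomial in
/-- The linear map sending a family of polynomials `g n` to `∑ n, g n (B) * A ^ n`. -/
def normalOrdered (q : ℂ) : (ℕ →₀ ℂ[X]) →ₗ[ℂ] HAlg q :=
  Finsupp.lsum ℂ fun n =>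
    (LinearMap.mulRight ℂ (genA q ^ n)).comp (aeval (genB q)).toLinearMap

open Polynomial in
lemma normalOrdered_single (q : ℂ) (n : ℕ) (f : ℂ[X]) :
    normalOrdered q (Finsupp.single n f) = aeval (genB q) f * genA q ^ n := by
  simp [normalOrdered]

open Polynomial in
lemma genA_mul_aeval_genB (q : ℂ) (f : ℂ[X]) :
    ∃ g h : ℂ[X], genA q * aeval (genB q) f =
      aeval (genB q) g * genA q + aeval (genB q) h := by
  induction f using Polynomial.induction_on' with
  | add f₁ f₂ h₁ h₂ =>
    obtain ⟨g₁, h₁, e₁⟩ := h₁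
    obtain ⟨g₂, h₂, e₂⟩ := h₂
    refine ⟨g₁ + g₂, h₁ + h₂, ?_⟩
    simp only [map_add, mul_add, e₁, e₂, add_mul]
    abel
  | monomial n a =>
    induction n with
    | zero =>
      refine ⟨C a, 0, ?_⟩
      simp [Algebra.commutes]
    | succ n ih =>
      obtain ⟨g, h, e⟩ := ih
      refine ⟨q • (X * g), q • (X * h) + monomial n a, ?_⟩
      rw [← X_mul_monomial, map_mul, aeval_X, ← mul_assoc, genA_mul_genB, add_mul, one_mul,
        smul_mul_assoc, mul_assoc, e]
      simp only [map_add, map_smul, map_mul, aeval_X, mul_add, smul_add, smul_mul_assoc,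
        mul_assoc]
      abel

lemma normalOrdered_surjective (q : ℂ) : Function.Surjective (normalOrdered q) := by
  let S := LinearMap.range (normalOrdered q)
  have hS : ∀ n f, Polynomial.aeval (genB q) f * genA q ^ n ∈ S := fun n f =>
    ⟨Finsupp.single n f, normalOrdered_single q n f⟩
  have key : ∀ x y : HAlg q, y ∈ S → x * y ∈ S := by
    intro x
    have hx : x ∈ Algebra.adjoin ℂ {genA q, genB q} := by
      rw [HAlg.adjoin_eq_top]; trivial
    induction hx using Algebra.adjoin_induction with
    | mem x hx =>
      rintro _ ⟨g, rfl⟩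
      induction g using Finsupp.induction_linear with
      | zero => simp
      | add f g hf hg => rw [map_add, mul_add]; exact S.add_mem hf hg
      | single n f =>
        rw [normalOrdered_single, ← mul_assoc]
        rcases hx with rfl | rfl
        · obtain ⟨g, h, e⟩ := genA_mul_aeval_genB q f
          rw [e, add_mul, mul_assoc, ← pow_succ']
          exact S.add_mem (hS _ _) (hS _ _)
        · have e : genB q * Polynomial.aeval (genB q) f =
              Polynomial.aeval (genB q) (Polynomial.X * f) := by
            rw [map_mul, Polynomial.aeval_X]
          rw [e]
          exact hS _ _
    | algebraMap r => intro y hy; rw [← Algebra.smul_def]; exact S.smul_mem r hy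
    | add a b _ _ ha hb => intro y hy; rw [add_mul]; exact S.add_mem (ha y hy) (hb y hy)
    | mul a b _ _ ha hb => intro y hy; rw [mul_assoc]; exact ha _ (hb y hy)
  intro x
  have := key x 1 (by simpa using hS 0 1)
  rwa [mul_one] at this

open Polynomial in
lemma qDeriv_pow_monomial_of_lt (q : ℂ) {k n : ℕ} (h : n < k) (a : ℂ) :
    (qDeriv q ^ k) (monomial n a) = 0 := by
  induction k generalizing n a with
  | zero => omega
  | succ k ih =>
    rw [pow_succ, Module.End.mul_apply, qDeriv_monomial]
    rcases n with _ | n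
    · simp
    · exact ih (by omega) _

open Polynomial in
lemma exists_qDeriv_pow_monomial_self {q : ℂ} (hq : ∀ n : ℕ, q ^ (n + 1) ≠ 1) (n : ℕ) {a : ℂ}
    (ha : a ≠ 0) : ∃ c : ℂ, c ≠ 0 ∧ (qDeriv q ^ n) (monomial n a) = C c := by
  induction n generalizing a with
  | zero => exact ⟨a, ha, by simp⟩
  | succ n ih =>
    rw [pow_succ, Module.End.mul_apply, qDeriv_monomial]
    refine ih (mul_ne_zero (div_ne_zero (sub_ne_zero.mpr (hq n).symm) ?_) ha)
    simpa using sub_ne_zero.mpr (hq 0).symm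

open Polynomial in
lemma aeval_mulXLin (f g : ℂ[X]) : aeval mulXLin f g = f * g := by
  induction f using Polynomial.induction_on' with
  | add f₁ f₂ h₁ h₂ => rw [map_add, LinearMap.add_apply, h₁, h₂, add_mul]
  | monomial n a =>
    simp [mulXLin, ← C_mul_X_pow_eq_monomial, ← smul_eq_C_mul]

open Polynomial in
/-- The representation of `H(q)` by multiplication by `X` and the `q`-derivative is faithful. -/
lemma HAlg.fock_injective {q : ℂ} (hq : ∀ n : ℕ, q ^ (n + 1) ≠ 1)
    (ρ : HAlg q →ₐ[ℂ] Module.End ℂ ℂ[X]) (hA : ρ (genA q) = qDeriv q)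
    (hB : ρ (genB q) = mulXLin) : Function.Injective ρ := by
  rw [injective_iff_map_eq_zero]
  intro x hx
  obtain ⟨g, rfl⟩ := normalOrdered_surjective q x
  suffices hg : ∀ n, g n = 0 by rw [show g = 0 from Finsupp.ext hg, map_zero]
  have hsum : ∀ v : ℂ[X], g.sum (fun k f => f * (qDeriv q ^ k) v) = 0 := by
    intro v
    have := LinearMap.congr_fun hx v
    rw [normalOrdered, Finsupp.lsum_apply, Finsupp.sum, map_sum, LinearMap.sum_apply] at this
    simpa [Finsupp.sum, hA, hB, ← aeval_algHom_apply, aeval_mulXLin] using this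
  intro n
  induction n using Nat.strong_induction_on with
  | _ n ih =>
    obtain ⟨c, hc, e⟩ := exists_qDeriv_pow_monomial_self hq n one_ne_zero
    have h := hsum (monomial n 1)
    rw [Finsupp.sum, Finset.sum_eq_single n, e] at h
    · simpa [hc] using h
    · intro k _ hk
      rcases lt_or_gt_of_ne hk with hk | hk
      · rw [ih k hk, zero_mul]
      · rw [qDeriv_pow_monomial_of_lt q hk, mul_zero]
    · intro hn
      rw [Finsupp.notMem_support_iff.mp hn, zero_mul]

/-- With `p = e^{-ω}`, `q = p²` (`ω > 0`), the unique unital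
`ℂ`-algebra homomorphism `H(q) → P` sending the generator `A` of `H(q)` to `A ∈ P` and
`B` to `B ∈ P` is injective; hence the unital subalgebra of `P` generated by `A` and `B`
is isomorphic to `H(q)`. -/
theorem statement_13 (ω : ℝ) (hω : 0 < ω) :
    (∃! Ψ : HAlg ((Real.exp (-ω) : ℂ) ^ 2) →ₐ[ℂ] PAlg (Real.exp (-ω) : ℂ),
      Ψ (genA ((Real.exp (-ω) : ℂ) ^ 2)) = pA (Real.exp (-ω) : ℂ) ∧
      Ψ (genB ((Real.exp (-ω) : ℂ) ^ 2)) = pB (Real.exp (-ω) : ℂ)) ∧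
    (∀ Ψ : HAlg ((Real.exp (-ω) : ℂ) ^ 2) →ₐ[ℂ] PAlg (Real.exp (-ω) : ℂ),
      Ψ (genA ((Real.exp (-ω) : ℂ) ^ 2)) = pA (Real.exp (-ω) : ℂ) →
      Ψ (genB ((Real.exp (-ω) : ℂ) ^ 2)) = pB (Real.exp (-ω) : ℂ) →
      Function.Injective Ψ) ∧
    Nonempty (HAlg ((Real.exp (-ω) : ℂ) ^ 2) ≃ₐ[ℂ]
      Algebra.adjoin ℂ ({pA (Real.exp (-ω) : ℂ), pB (Real.exp (-ω) : ℂ)} :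
        Set (PAlg (Real.exp (-ω) : ℂ)))) := by
  have hp₀ : (Real.exp (-ω) : ℂ) ≠ 0 := by exact_mod_cast (Real.exp_pos (-ω)).ne'
  have hq : ∀ n : ℕ, ((Real.exp (-ω) : ℂ) ^ 2) ^ (n + 1) ≠ 1 := by
    intro n h
    have h' : (Real.exp (-ω) ^ 2) ^ (n + 1) = 1 := by exact_mod_cast h
    rw [← pow_mul] at h'
    exact (pow_lt_one₀ (Real.exp_pos _).le (Real.exp_lt_one_iff.mpr (by linarith)) (by omega)).ne h'
  generalize (Real.exp (-ω) : ℂ) = p at hp₀ hq ⊢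
  have hp : p ^ 2 ≠ 1 := by simpa using hq 0
  have hinj : ∀ Ψ : HAlg (p ^ 2) →ₐ[ℂ] PAlg p, Ψ (genA (p ^ 2)) = pA p →
      Ψ (genB (p ^ 2)) = pB p → Function.Injective Ψ := by
    intro Ψ hA hB
    have h := HAlg.fock_injective hq ((fockP hp₀ hp).comp Ψ)
      (by rw [AlgHom.comp_apply, hA, fockP_pA]) (by rw [AlgHom.comp_apply, hB, fockP_pB])
    rw [AlgHom.coe_comp] at h
    exact h.of_comp
  let Ψ := HAlg.lift (p ^ 2) (pA p) (pB p) (pA_mul_pB hp)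
  have hA : Ψ (genA (p ^ 2)) = pA p := HAlg.lift_genA _ _ _ _
  have hB : Ψ (genB (p ^ 2)) = pB p := HAlg.lift_genB _ _ _ _
  refine ⟨⟨Ψ, ⟨hA, hB⟩, fun Φ h => HAlg.hom_ext (h.1.trans hA.symm) (h.2.trans hB.symm)⟩,
    hinj, ⟨(AlgEquiv.ofInjective Ψ (hinj Ψ hA hB)).trans (Subalgebra.equivOfEq _ _ ?_)⟩⟩
  rw [← Algebra.map_top, ← HAlg.adjoin_eq_top, AlgHom.map_adjoin, Set.image_pair, hA, hB]
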